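/- Let k be a field and A a finite-dimensional Hopf algebra over k whose antipode S is involutory (S ∘ S = id), with (dim_k A : k) ≠ 0. Let Λ ∈ A be the unique two-sided integral element with ε(Λ) = (dim_k A : k), and let λ : A → k be the unique two-sided integral functional with λ(1_A) = (dim_k A : k). Then: (1) Λ is cosymmetric, i.e. the flip map τ : A ⊗ A → A ⊗ A (τ(a ⊗ b) = b ⊗ a) satisfies τ(Δ(Λ)) = Δ(Λ); (2) λ is symmetric, i.e. λ(a * b) = λ(b * a) for all a, b ∈ A; and (3) λ is S-invariant, i.e. λ(S(a)) = λ(a) for all a ∈ A. -/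

import Mathlib

open scoped TensorProduct

open Coalgebra HopfAlgebra

lemma sum_counit_right_smul_left {k A ι : Type*} [CommSemiring k] [AddCommMonoid A] [Module k A]
    [Coalgebra k A] {a : A} (r : Repr k a ι) :
    ∑ i ∈ r.index, counit (R := k) (r.right i) • r.left i = a := by
  have h := congr(TensorProduct.rid k A $(sum_tmul_counit_eq (R := k) r))
  simpa only [map_sum, TensorProduct.rid_tmul, one_smul] using h

section Involutory

variable {k A : Type*} [Field k] [Ring A] [HopfAlgebra k A]

/-- In an involutory Hopf algebra, `S(a₂) a₁ = ε(a)`. -/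
lemma sum_antipode_right_mul_left (hS : ∀ a : A, antipode k (antipode k a) = a)
    {a : A} {ι : Type*} (r : Repr k a ι) :
    ∑ i ∈ r.index, antipode k (r.right i) * r.left i = counit (R := k) a • (1 : A) := by
  simpa [antipode_mul_antidistrib, hS] using
    congr(antipode k $(sum_antipode_mul_eq_smul (R := k) r))

/-- In an involutory Hopf algebra, `a₂ S(a₁) = ε(a)`. -/
lemma sum_right_mul_antipode_left (hS : ∀ a : A, antipode k (antipode k a) = a)
    {a : A} {ι : Type*} (r : Repr k a ι) :
    ∑ i ∈ r.index, r.right i * antipode k (r.left i) = counit (R := k) a • (1 : A) := by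
  simpa [antipode_mul_antidistrib, hS] using
    congr(antipode k $(sum_mul_antipode_eq_smul (R := k) r))

/-- In an involutory Hopf algebra, `a₁ ⊗ S(a₃) a₂ = a ⊗ 1`. -/
lemma sum_one_tmul_antipode_mul_comul (hS : ∀ a : A, antipode k (antipode k a) = a)
    {a : A} {ι : Type*} (r : Repr k a ι) :
    ∑ i ∈ r.index, (1 ⊗ₜ[k] antipode k (r.right i)) * comul (R := k) (r.left i) =
      a ⊗ₜ[k] (1 : A) := by
  let m : A ⊗[k] A →ₗ[k] A :=
    LinearMap.mul' k A ∘ₗ TensorProduct.map (antipode k) .id ∘ₗ (TensorProduct.comm k A A)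
  have hm (b : A) : m (comul b) = counit (R := k) b • (1 : A) := by
    rw [← sum_antipode_right_mul_left hS (ℛ k b), ← (ℛ k b).eq]
    simp [m]
  have h := congr(m.lTensor A $(coassoc_apply (R := k) a))
  rw [← r.eq] at h
  simp only [map_sum, LinearMap.rTensor_tmul, LinearMap.lTensor_tmul, hm] at h
  have e (t : A ⊗[k] A) (z : A) :
      m.lTensor A (TensorProduct.assoc k A A A (t ⊗ₜ z)) = (1 ⊗ₜ[k] antipode k z) * t := by
    induction t with
    | zero => simp
    | add x y hx hy => simp [TensorProduct.add_tmul, mul_add, hx, hy]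
    | tmul x y => simp [m]
  simp only [e] at h
  rw [h]
  simp only [← TensorProduct.smul_tmul, ← TensorProduct.sum_tmul, sum_counit_right_smul_left]

/-- In an involutory Hopf algebra, `a₂ S(a₁) ⊗ a₃ = 1 ⊗ a`. -/
lemma sum_comul_mul_antipode_tmul_one (hS : ∀ a : A, antipode k (antipode k a) = a)
    {a : A} {ι : Type*} (r : Repr k a ι) :
    ∑ i ∈ r.index, comul (R := k) (r.right i) * (antipode k (r.left i) ⊗ₜ[k] 1) =
      (1 : A) ⊗ₜ[k] a := by
  let m : A ⊗[k] A →ₗ[k] A :=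
    LinearMap.mul' k A ∘ₗ TensorProduct.map .id (antipode k) ∘ₗ (TensorProduct.comm k A A)
  have hm (b : A) : m (comul b) = counit (R := k) b • (1 : A) := by
    rw [← sum_right_mul_antipode_left hS (ℛ k b), ← (ℛ k b).eq]
    simp [m]
  have h := congr(m.rTensor A $(coassoc_symm_apply (R := k) a))
  rw [← r.eq] at h
  simp only [map_sum, LinearMap.rTensor_tmul, LinearMap.lTensor_tmul, hm] at h
  have e (t : A ⊗[k] A) (z : A) :
      m.rTensor A ((TensorProduct.assoc k A A A).symm (z ⊗ₜ t)) =
        t * (antipode k z ⊗ₜ[k] 1) := by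
    induction t with
    | zero => simp
    | add x y hx hy => simp [TensorProduct.tmul_add, add_mul, hx, hy]
    | tmul x y => simp [m]
  simp only [e] at h
  rw [h]
  simp only [TensorProduct.smul_tmul, ← TensorProduct.tmul_sum, sum_counit_smul]

/-- For a left integral `Λ` of an involutory Hopf algebra, `a Λ₁ ⊗ Λ₂ = Λ₁ ⊗ S(a) Λ₂`. -/
lemma tmul_one_mul_comul_integral (hS : ∀ a : A, antipode k (antipode k a) = a) {Λ : A}
    (hΛ : ∀ a : A, a * Λ = counit (R := k) a • Λ) (a : A) :
    (a ⊗ₜ[k] 1) * comul (R := k) Λ = (1 ⊗ₜ[k] antipode k a) * comul (R := k) Λ := by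
  rw [← sum_one_tmul_antipode_mul_comul hS (ℛ k a), Finset.sum_mul]
  simp_rw [mul_assoc, ← Bialgebra.comul_mul, hΛ, map_smul, mul_smul_comm, ← smul_mul_assoc]
  rw [← Finset.sum_mul]
  simp_rw [← TensorProduct.tmul_smul, ← map_smul, ← TensorProduct.tmul_sum, ← map_sum,
    sum_counit_smul]

/-- For a right integral `Λ` of an involutory Hopf algebra, `Λ₁ ⊗ Λ₂ a = Λ₁ S(a) ⊗ Λ₂`. -/
lemma comul_integral_mul_one_tmul (hS : ∀ a : A, antipode k (antipode k a) = a) {Λ : A}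
    (hΛ : ∀ a : A, Λ * a = counit (R := k) a • Λ) (a : A) :
    comul (R := k) Λ * (1 ⊗ₜ[k] a) = comul (R := k) Λ * (antipode k a ⊗ₜ[k] 1) := by
  rw [← sum_comul_mul_antipode_tmul_one hS (ℛ k a), Finset.mul_sum]
  simp_rw [← mul_assoc, ← Bialgebra.comul_mul, hΛ, map_smul, smul_mul_assoc, ← mul_smul_comm]
  rw [← Finset.mul_sum]
  simp_rw [TensorProduct.smul_tmul', ← map_smul, ← TensorProduct.sum_tmul, ← map_sum,
    sum_counit_right_smul_left]

/-- Dual bases: `λ(a Λ₁) S(Λ₂) = λ(Λ) a`. -/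
lemma sum_apply_mul_left_smul_antipode (hS : ∀ a : A, antipode k (antipode k a) = a) {Λ : A}
    (hΛ : ∀ a : A, a * Λ = counit (R := k) a • Λ) {lam : A →ₗ[k] k}
    (hlam : ∀ a : A, TensorProduct.lid k A (TensorProduct.map lam .id (comul (R := k) a)) =
      lam a • (1 : A)) {ι : Type*} (r : Repr k Λ ι) (a : A) :
    ∑ i ∈ r.index, lam (a * r.left i) • antipode k (r.right i) = lam Λ • a := by
  have h := congr(antipode k (TensorProduct.lid k A (TensorProduct.map lam .id
    $(tmul_one_mul_comul_integral hS hΛ a))))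
  have h' := congr(antipode k $(hlam Λ))
  simp only [← r.eq, Finset.mul_sum, map_sum, Algebra.TensorProduct.tmul_mul_tmul, one_mul,
    TensorProduct.map_tmul, TensorProduct.lid_tmul, map_smul, LinearMap.id_apply,
    antipode_mul_antidistrib, hS, antipode_one] at h h'
  rw [h]
  simp_rw [← smul_mul_assoc]
  rw [← Finset.sum_mul, h', smul_mul_assoc, one_mul]

/-- Dual bases: `λ(Λ₂ a) S(Λ₁) = λ(Λ) a`. -/
lemma sum_apply_right_mul_smul_antipode (hS : ∀ a : A, antipode k (antipode k a) = a) {Λ : A}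
    (hΛ : ∀ a : A, Λ * a = counit (R := k) a • Λ) {lam : A →ₗ[k] k}
    (hlam : ∀ a : A, TensorProduct.rid k A (TensorProduct.map .id lam (comul (R := k) a)) =
      lam a • (1 : A)) {ι : Type*} (r : Repr k Λ ι) (a : A) :
    ∑ i ∈ r.index, lam (r.right i * a) • antipode k (r.left i) = lam Λ • a := by
  have h := congr(antipode k (TensorProduct.rid k A (TensorProduct.map .id lam
    $(comul_integral_mul_one_tmul hS hΛ a))))
  have h' := congr(antipode k $(hlam Λ))
  simp only [← r.eq, Finset.sum_mul, map_sum, Algebra.TensorProduct.tmul_mul_tmul, mul_one,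
    TensorProduct.map_tmul, TensorProduct.rid_tmul, map_smul, LinearMap.id_apply,
    antipode_mul_antidistrib, hS, antipode_one] at h h'
  rw [h]
  simp_rw [← mul_smul_comm]
  rw [← Finset.mul_sum, h', mul_smul_comm, mul_one]

end Involutory

/-- The trace of an endomorphism in terms of dual bases for a bilinear form `λ(a b)`. -/
lemma mul_trace_eq_sum_of_dual_bases {k A ι : Type*} [Field k] [Ring A] [Algebra k A]
    [FiniteDimensional k A] {lam : A →ₗ[k] k} {s : Finset ι} {u v : ι → A} {c : k}
    (h : ∀ a : A, ∑ i ∈ s, lam (a * u i) • v i = c • a) (f : A →ₗ[k] A) :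
    c * LinearMap.trace k A f = ∑ i ∈ s, lam (f (v i) * u i) := by
  have hf : c • f =
      ∑ i ∈ s, ((lam ∘ₗ LinearMap.mulRight k (u i)).smulRight (v i)) ∘ₗ f := by
    ext a
    simp [LinearMap.sum_apply, h]
  rw [← smul_eq_mul, ← map_smul, hf, map_sum]
  refine Finset.sum_congr rfl fun i _ ↦ ?_
  rw [LinearMap.trace_comp_comm', show f ∘ₗ (lam ∘ₗ LinearMap.mulRight k (u i)).smulRight (v i) =
    (lam ∘ₗ LinearMap.mulRight k (u i)).smulRight (f (v i)) by ext; simp,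
    LinearMap.trace_smulRight]
  simp

/-- Any two pairs of dual bases for a symmetric form `λ(a b)` define the same tensor, up to the
flip. -/
lemma sum_tmul_eq_of_dual_bases {k A ι κ : Type*} [Field k] [Ring A] [Algebra k A]
    {lam : A →ₗ[k] k} {s : Finset ι} {t : Finset κ} {u v : ι → A} {u' v' : κ → A} {c : k}
    (hc : c ≠ 0) (hlam : ∀ a b : A, lam (a * b) = lam (b * a))
    (h : ∀ a : A, ∑ i ∈ s, lam (a * u i) • v i = c • a)
    (h' : ∀ a : A, ∑ j ∈ t, lam (a * u' j) • v' j = c • a) :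
    ∑ i ∈ s, v i ⊗ₜ[k] u i = ∑ j ∈ t, u' j ⊗ₜ[k] v' j := by
  refine smul_right_injective _ hc ?_
  calc c • ∑ i ∈ s, v i ⊗ₜ[k] u i
      = ∑ i ∈ s, ∑ j ∈ t, v i ⊗ₜ[k] (lam (u i * u' j) • v' j) := by
        simp_rw [← TensorProduct.tmul_sum, h', TensorProduct.tmul_smul, Finset.smul_sum]
    _ = ∑ j ∈ t, ∑ i ∈ s, (lam (u' j * u i) • v i) ⊗ₜ[k] v' j := by
        rw [Finset.sum_comm]
        simp_rw [TensorProduct.smul_tmul, hlam (u _)]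
    _ = c • ∑ j ∈ t, u' j ⊗ₜ[k] v' j := by
        simp_rw [← TensorProduct.sum_tmul, h, ← TensorProduct.smul_tmul', Finset.smul_sum]

/-- For a finite-dimensional involutory Hopf algebra `A` over `k` with
`(dim_k A : k) ≠ 0`, the two-sided integral element `Λ` with `ε Λ = dim_k A` is
cosymmetric, and the two-sided integral functional `λ` with `λ 1 = dim_k A` is
symmetric and invariant under the antipode. -/
theorem involutory_hopf_integrals_symmetric (k A : Type*) [Field k] [Ring A]
    [HopfAlgebra k A] [FiniteDimensional k A]
    (hS : ∀ a : A, HopfAlgebra.antipode (R := k) (HopfAlgebra.antipode (R := k) a) = a)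
    (hdim : (Module.finrank k A : k) ≠ 0)
    (Λ : A)
    (hΛ : ∀ a : A, Λ * a = Coalgebra.counit (R := k) a • Λ ∧
        a * Λ = Coalgebra.counit (R := k) a • Λ)
    (hΛε : Coalgebra.counit (R := k) Λ = (Module.finrank k A : k))
    (lam : A →ₗ[k] k)
    (hlam : ∀ a : A,
      (TensorProduct.rid k A) ((TensorProduct.map LinearMap.id lam)
        (Coalgebra.comul (R := k) a)) = lam a • (1 : A) ∧
      (TensorProduct.lid k A) ((TensorProduct.map lam LinearMap.id)
        (Coalgebra.comul (R := k) a)) = lam a • (1 : A))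
    (hlam1 : lam 1 = (Module.finrank k A : k)) :
    (TensorProduct.comm k A A) (Coalgebra.comul (R := k) Λ) = Coalgebra.comul (R := k) Λ ∧
    (∀ a b : A, lam (a * b) = lam (b * a)) ∧
    (∀ a : A, lam (HopfAlgebra.antipode (R := k) a) = lam a) := by
  have hdual := sum_apply_mul_left_smul_antipode hS (fun a ↦ (hΛ a).2) (fun a ↦ (hlam a).2) (ℛ k Λ)
  have hdual' := sum_apply_right_mul_smul_antipode hS (fun a ↦ (hΛ a).1) (fun a ↦ (hlam a).1)
    (ℛ k Λ)
  have htr_left (b : A) : lam Λ * LinearMap.trace k A (LinearMap.mulLeft k b) =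
      (Module.finrank k A : k) * lam b := by
    rw [mul_trace_eq_sum_of_dual_bases hdual]
    simp_rw [LinearMap.mulLeft_apply, mul_assoc]
    rw [← map_sum, ← Finset.mul_sum, sum_antipode_right_mul_left hS, hΛε, mul_smul_comm, mul_one,
      map_smul, smul_eq_mul]
  have hlamΛ : lam Λ = (Module.finrank k A : k) := by
    have h := htr_left 1
    rw [LinearMap.mulLeft_one, LinearMap.trace_id, hlam1] at h
    exact mul_right_cancel₀ hdim h
  rw [hlamΛ] at htr_left hdual hdual'
  have hlam_left (b : A) : lam b = LinearMap.trace k A (LinearMap.mulLeft k b) :=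
    (mul_left_cancel₀ hdim (htr_left b)).symm
  have hsymm (a b : A) : lam (a * b) = lam (b * a) := by
    rw [hlam_left, hlam_left, LinearMap.mulLeft_mul, LinearMap.mulLeft_mul,
      LinearMap.trace_comp_comm']
  have hlam_right (b : A) : lam b = LinearMap.trace k A (LinearMap.mulRight k b) := by
    refine mul_left_cancel₀ hdim ?_
    rw [mul_trace_eq_sum_of_dual_bases hdual]
    simp_rw [LinearMap.mulRight_apply, mul_assoc, hsymm (antipode k _), mul_assoc]
    rw [← map_sum, ← Finset.mul_sum, sum_mul_antipode_eq_smul, hΛε, mul_smul_comm, mul_one,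
      map_smul, smul_eq_mul]
  refine ⟨?_, hsymm, fun a ↦ ?_⟩
  · set r := ℛ k Λ
    have hpair := sum_tmul_eq_of_dual_bases hdim hsymm hdual hdual
    have hpair' := sum_tmul_eq_of_dual_bases hdim hsymm hdual
      (fun a ↦ by simpa only [hsymm a] using hdual' a)
    rw [← r.eq]
    simpa [hS] using congr((antipode k).lTensor A $(hpair'.symm.trans hpair))
  · rw [hlam_left, hlam_right]
    have h : LinearMap.mulLeft k (antipode k a) =
        (antipode k : A →ₗ[k] A) ∘ₗ (LinearMap.mulRight k a ∘ₗ antipode k) := by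
      ext x
      simp [antipode_mul_antidistrib, hS]
    rw [h, LinearMap.trace_comp_comm', LinearMap.comp_assoc,
      show antipode k ∘ₗ antipode k = (LinearMap.id : A →ₗ[k] A) from LinearMap.ext hS,
      LinearMap.comp_id]
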